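/- Let 1 ≤ m ≤ n, let (π_2, …, π_m) ∈ [n]^{m−1}, and let k ∈ [n]. Then A^n_{(π_2, …, π_m)} = [k] (i.e., A^n_{(π_2, …, π_m)} = {1, 2, …, k}) if and only if (π_2, …, π_m) ∈ Sh_m(k−1, n−k). -/

import Mathlib

/-- One step of the `t`-metered parking process on spots `1,…,n`:
given the outcome list `prev` for the cars that have already entered
(`prev[j-1] = some s` if car `j` parked in spot `s`, `none` if it failed to park),
compute the outcome list after the next car (with preference `pref`) tries to park.
When the next car enters, the occupied spots are exactly the spots of the previous
`t` cars that are still on the street (all earlier cars have already left), and the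
entering car parks in the smallest unoccupied spot `≥ pref` among `1,…,n`, if any. -/
def parkStep (n t : ℕ) (prev : List (Option ℕ)) (pref : ℕ) : List (Option ℕ) :=
  let occ : List ℕ := (prev.drop (prev.length - t)).filterMap id
  prev ++ [((List.range' pref (n + 1 - pref)).filter (fun s => decide (s ∉ occ))).head?]

/-- The outcome of the `t`-metered parking process on spots `1,…,n` for the
preference list `l` (car `i` prefers spot `l[i-1]`); the `i`-th entry is
`some s` if car `i` parks in spot `s`, and `none` if car `i` fails to park. -/
def parkOutcome (n t : ℕ) (l : List ℕ) : List (Option ℕ) :=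
  l.foldl (parkStep n t) []

/-- `l` is a `t`-metered `(m,n)`-parking function: a preference list in `[n]^m`
under which every car parks in the `t`-metered parking scheme. -/
def MeteredPF (m n t : ℕ) (l : List ℕ) : Prop :=
  l.length = m ∧ (∀ x ∈ l, x ∈ Finset.Icc 1 n) ∧
    ∀ o ∈ parkOutcome n t l, o.isSome

/-- `l` is a classical `(m,n)`-parking function: a preference list in `[n]^m` under
which every car parks when no car ever leaves (equivalently, the `t`-metered scheme
with `t = m`, under which no car leaves while cars are still arriving). -/
def ParkingFunction (m n : ℕ) (l : List ℕ) : Prop :=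
  l.length = m ∧ (∀ x ∈ l, x ∈ Finset.Icc 1 n) ∧
    ∀ o ∈ parkOutcome n m l, o.isSome

/-- `IsShuffle β δ γ`: the word `γ` is a shuffle of the words `β` and `δ`, i.e. `γ`
can be partitioned into two complementary subsequences equal, in order, to `β`
and `δ`. -/
inductive IsShuffle : List ℕ → List ℕ → List ℕ → Prop
  | nil : IsShuffle [] [] []
  | left {x : ℕ} {xs ys zs : List ℕ} : IsShuffle xs ys zs → IsShuffle (x :: xs) ys (x :: zs)
  | right {y : ℕ} {xs ys zs : List ℕ} : IsShuffle xs ys zs → IsShuffle xs (y :: ys) (y :: zs)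

/-- `ShSet m n k` is the set `Sh_m(k-1, n-k)` of `(m,n)`-parking function shuffles:
sequences `(π_2, …, π_m)` that are shuffles of some `α ∈ PF_{m-n+k-1, k-1}` and a word
`β + (k)^{n-k} = (b_1 + k, …, b_{n-k} + k)` with `β = (b_1,…,b_{n-k}) ∈ PF_{n-k, n-k}`.
If `m - n + k - 1 < 0` (i.e. `m + k < n + 1`) the set is empty. -/
def ShSet (m n k : ℕ) : Set (List ℕ) :=
  {π | n + 1 ≤ m + k ∧ ∃ a b : List ℕ,
      ParkingFunction (m + k - n - 1) (k - 1) a ∧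
      ParkingFunction (n - k) (n - k) b ∧
      IsShuffle a (b.map (· + k)) π}

theorem parkOutcome_concat (n t : ℕ) (l : List ℕ) (p : ℕ) :
    parkOutcome n t (l ++ [p]) = parkStep n t (parkOutcome n t l) p := by
  simp [parkOutcome, List.foldl_append]

theorem length_parkOutcome (n t : ℕ) (l : List ℕ) :
    (parkOutcome n t l).length = l.length := by
  induction l using List.reverseRecOn with
  | nil => rfl
  | append_singleton l p ih => simp [parkOutcome_concat, parkStep, ih]

/-- The spot in which a car with preference `p` parks when the spots in `occ` are taken. -/
def nextSpot (n : ℕ) (occ : List ℕ) (p : ℕ) : Option ℕ :=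
  ((List.range' p (n + 1 - p)).filter (fun s => decide (s ∉ occ))).head?

theorem nextSpot_eq_none {n p : ℕ} {occ : List ℕ} (h : nextSpot n occ p = none) :
    ∀ u, p ≤ u → u ≤ n → u ∈ occ := by
  intro u hpu hun
  simp only [nextSpot, List.head?_eq_none_iff, List.filter_eq_nil_iff, List.mem_range'_1,
    decide_eq_true_eq, not_not] at h
  exact h u (by omega)

theorem nextSpot_eq_some {n p q : ℕ} {occ : List ℕ} (h : nextSpot n occ p = some q) :
    p ≤ q ∧ q ≤ n ∧ q ∉ occ ∧ ∀ u, p ≤ u → u < q → u ∈ occ := by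
  rw [nextSpot, List.head?_filter, List.find?_range'_eq_some] at h
  obtain ⟨hq, hr, hlt⟩ := h
  rw [List.mem_range'_1] at hr
  refine ⟨hr.1, by omega, by simpa using hq, fun u hpu huq => ?_⟩
  simpa using hlt u hpu huq

/-- The list of the spots taken by the cars that manage to park. -/
def occupiedSpots (n t : ℕ) (l : List ℕ) : List ℕ :=
  (parkOutcome n t l).filterMap id

theorem parkOutcome_concat_of_length_le {n t : ℕ} {l : List ℕ} (h : l.length ≤ t) (p : ℕ) :
    parkOutcome n t (l ++ [p]) =
      parkOutcome n t l ++ [nextSpot n (occupiedSpots n t l) p] := by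
  have h0 : (parkOutcome n t l).length - t = 0 := by
    rw [length_parkOutcome]; omega
  rw [parkOutcome_concat, parkStep, h0, List.drop_zero]
  rfl

theorem occupiedSpots_concat {n t : ℕ} {l : List ℕ} (h : l.length ≤ t) (p : ℕ) :
    occupiedSpots n t (l ++ [p]) =
      occupiedSpots n t l ++ (nextSpot n (occupiedSpots n t l) p).toList := by
  rw [occupiedSpots, parkOutcome_concat_of_length_le h, List.filterMap_append]
  congr 1

theorem nodup_occupiedSpots {n t : ℕ} {l : List ℕ} (h : l.length ≤ t) :
    (occupiedSpots n t l).Nodup ∧ ∀ x ∈ occupiedSpots n t l, x ≤ n := by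
  induction l using List.reverseRecOn with
  | nil => simp [occupiedSpots, parkOutcome]
  | append_singleton l p ih =>
    simp only [List.length_append, List.length_singleton] at h
    obtain ⟨hnd, hle⟩ := ih (by omega)
    rw [occupiedSpots_concat (by omega)]
    cases hq : nextSpot n (occupiedSpots n t l) p with
    | none => simpa using ⟨hnd, hle⟩
    | some q =>
      obtain ⟨-, hqn, hqo, -⟩ := nextSpot_eq_some hq
      refine ⟨?_, ?_⟩
      · rw [Option.toList_some, ← List.concat_eq_append]
        exact hnd.concat hqo
      · intro x hx
        simp only [Option.toList_some, List.mem_append, List.mem_singleton] at hx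
        rcases hx with hx | rfl
        exacts [hle x hx, hqn]

theorem countP_le_countP_occupiedSpots {n t : ℕ} {l : List ℕ} (h : l.length ≤ t)
    (hs : ∀ o ∈ parkOutcome n t l, o.isSome) (s : ℕ) :
    l.countP (s ≤ ·) ≤ (occupiedSpots n t l).countP (s ≤ ·) := by
  induction l using List.reverseRecOn with
  | nil => simp
  | append_singleton l p ih =>
    simp only [List.length_append, List.length_singleton] at h
    rw [parkOutcome_concat_of_length_le (by omega)] at hs
    have ih := ih (by omega) fun o ho => hs o (List.mem_append_left _ ho)
    obtain ⟨q, hq⟩ := Option.isSome_iff_exists.1 (hs _ (List.mem_append_right _ (List.mem_singleton_self _)))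
    obtain ⟨hpq, -⟩ := nextSpot_eq_some hq
    rw [occupiedSpots_concat (by omega), hq]
    simp only [Option.toList_some, List.countP_append, List.countP_singleton, decide_eq_true_eq]
    split_ifs <;> omega

/-- No car whose preference is at most a free spot `u` has parked beyond `u`. -/
theorem countP_occupiedSpots_le {n t : ℕ} {l : List ℕ} (h : l.length ≤ t) {u : ℕ}
    (hu : u ∉ occupiedSpots n t l) :
    (occupiedSpots n t l).countP (u + 1 ≤ ·) ≤ l.countP (u + 1 ≤ ·) := by
  induction l using List.reverseRecOn with
  | nil => simp [occupiedSpots, parkOutcome]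
  | append_singleton l p ih =>
    simp only [List.length_append, List.length_singleton] at h
    rw [occupiedSpots_concat (by omega)] at hu ⊢
    have ih := ih (by omega) fun hm => hu (List.mem_append_left _ hm)
    rw [List.countP_append, List.countP_append]
    cases hq : nextSpot n (occupiedSpots n t l) p with
    | none =>
      simp only [Option.toList_none, List.countP_nil]
      omega
    | some q =>
      obtain ⟨-, -, -, hlt⟩ := nextSpot_eq_some hq
      have : u + 1 ≤ q → u + 1 ≤ p := fun h1 => by
        by_contra h2
        exact hu (List.mem_append_left _ (hlt u (by omega) (by omega)))
      simp only [Option.toList_some, List.countP_singleton, decide_eq_true_eq]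
      split_ifs <;> omega

theorem countP_le_of_nodup {n s : ℕ} {l : List ℕ} (hnd : l.Nodup) (hle : ∀ x ∈ l, x ≤ n) :
    l.countP (s ≤ ·) ≤ n + 1 - s := by
  rw [List.countP_eq_length_filter, ← List.toFinset_card_of_nodup (hnd.filter _),
    ← Nat.card_Icc]
  refine Finset.card_le_card fun x hx => ?_
  simp only [List.mem_toFinset, List.mem_filter, decide_eq_true_eq] at hx
  exact Finset.mem_Icc.2 ⟨hx.2, hle x hx.1⟩

theorem le_countP_of_forall_mem {n s : ℕ} {l : List ℕ} (h : ∀ x, s ≤ x → x ≤ n → x ∈ l) :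
    n + 1 - s ≤ l.countP (s ≤ ·) := by
  rw [List.countP_eq_length_filter, ← Nat.card_Icc]
  refine le_trans (Finset.card_le_card fun x hx => ?_) (List.toFinset_card_le _)
  rw [Finset.mem_Icc] at hx
  simpa using ⟨h x hx.1 hx.2, hx.1⟩

theorem isSome_parkOutcome_of_countP_le {n t : ℕ} {l : List ℕ} (h : l.length ≤ t)
    (hmem : ∀ x ∈ l, x ∈ Finset.Icc 1 n)
    (hc : ∀ s, 1 ≤ s → s ≤ n → l.countP (s ≤ ·) ≤ n + 1 - s) :
    ∀ o ∈ parkOutcome n t l, o.isSome := by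
  induction l using List.reverseRecOn with
  | nil => simp [parkOutcome]
  | append_singleton l p ih =>
    simp only [List.length_append, List.length_singleton] at h
    have hp := Finset.mem_Icc.1 (hmem p (by simp))
    simp only [List.countP_append, List.countP_singleton, decide_eq_true_eq] at hc
    have ih := ih (by omega) (fun x hx => hmem x (List.mem_append_left _ hx))
      fun s h1 h2 => le_trans (Nat.le_add_right _ _) (hc s h1 h2)
    rw [parkOutcome_concat_of_length_le (by omega)]
    intro o ho
    rw [List.mem_append, List.mem_singleton] at ho
    rcases ho with ho | rfl
    · exact ih o ho
    rw [Option.isSome_iff_ne_none]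
    intro hnone
    have hfull := nextSpot_eq_none hnone
    have hex : ∃ s, 1 ≤ s ∧ ∀ x, s ≤ x → x ≤ n → x ∈ occupiedSpots n t l := ⟨p, hp.1, hfull⟩
    classical
    obtain ⟨hs1, hsf⟩ := Nat.find_spec hex
    have hmin := fun r => Nat.find_min (m := r) hex
    have hsp : Nat.find hex ≤ p := Nat.find_min' hex ⟨hp.1, hfull⟩
    generalize Nat.find hex = s at *
    have hlow := le_countP_of_forall_mem hsf
    have hcs := hc s hs1 (by omega)
    rw [if_pos hsp] at hcs
    have hle : (occupiedSpots n t l).countP (s ≤ ·) ≤ l.countP (s ≤ ·) := by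
      obtain ⟨u, rfl⟩ : ∃ u, s = u + 1 := ⟨s - 1, by omega⟩
      by_cases hu : u ∈ occupiedSpots n t l
      · rcases Nat.eq_zero_or_pos u with rfl | hpos
        · have : l.countP (0 + 1 ≤ ·) = l.length := List.countP_eq_length.2 fun x hx => by
            simpa using (Finset.mem_Icc.1 (hmem x (List.mem_append_left _ hx))).1
          rw [this, ← length_parkOutcome n t l]
          exact List.countP_le_length.trans (List.length_filterMap_le _ _)
        · refine absurd ⟨hpos, fun x hux hxn => ?_⟩ (hmin u (by omega))
          rcases hux.eq_or_lt with rfl | hlt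
          exacts [hu, hsf x hlt hxn]
      · exact countP_occupiedSpots_le (by omega) hu
    omega

theorem parkingFunction_iff_countP_le {m n : ℕ} {l : List ℕ} :
    ParkingFunction m n l ↔ l.length = m ∧ (∀ x ∈ l, x ∈ Finset.Icc 1 n) ∧
      ∀ s, 1 ≤ s → s ≤ n → l.countP (s ≤ ·) ≤ n + 1 - s := by
  refine and_congr_right fun hl => and_congr_right fun hmem => ⟨fun h s _ _ => ?_, fun h => ?_⟩
  · obtain ⟨hnd, hle⟩ := nodup_occupiedSpots (n := n) hl.le
    exact (countP_le_countP_occupiedSpots hl.le h s).trans (countP_le_of_nodup hnd hle)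
  · exact isSome_parkOutcome_of_countP_le hl.le hmem h

theorem IsShuffle.perm {a b l : List ℕ} (h : IsShuffle a b l) : l.Perm (a ++ b) := by
  induction h with
  | nil => rfl
  | left _ ih => exact ih.cons _
  | right _ ih => exact (ih.cons _).trans List.perm_middle.symm

theorem isShuffle_filter (p : ℕ → Bool) (l : List ℕ) :
    IsShuffle (l.filter p) (l.filter fun x => !p x) l := by
  induction l with
  | nil => exact .nil
  | cons x l ih =>
    cases hx : p x
    · simpa [hx] using ih.right
    · simpa [hx] using ih.left

theorem countP_le_map_add (k s : ℕ) (b : List ℕ) :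
    (b.map (· + k)).countP (s ≤ ·) = b.countP (s - k ≤ ·) := by
  rw [List.countP_map]
  congr 1
  funext x
  simp

/-- The preferences that the first car may have, in terms of tail counts of the others. -/
theorem setOf_parkingFunction_cons_eq_Icc_iff {m n k : ℕ} (h1 : 1 ≤ m)
    (hk : k ∈ Finset.Icc 1 n) {π : List ℕ} (hlen : π.length = m - 1)
    (hmem : ∀ x ∈ π, x ∈ Finset.Icc 1 n) :
    {j : ℕ | j ∈ Finset.Icc 1 n ∧ ParkingFunction m n (j :: π)} = ↑(Finset.Icc 1 k) ↔
      (∀ s, 1 ≤ s → s ≤ k → π.countP (s ≤ ·) ≤ n - s) ∧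
      (∀ s, 1 ≤ s → s ≤ n → π.countP (s ≤ ·) ≤ n + 1 - s) ∧
      π.countP (k + 1 ≤ ·) = n - k := by
  rw [Finset.mem_Icc] at hk
  have key : ∀ j, 1 ≤ j → j ≤ n → (ParkingFunction m n (j :: π) ↔
      ∀ s, 1 ≤ s → s ≤ n → π.countP (s ≤ ·) + (if s ≤ j then 1 else 0) ≤ n + 1 - s) := by
    intro j hj1 hjn
    have hlen' : (j :: π).length = m := by simp; omega
    have hmem' : ∀ x ∈ j :: π, x ∈ Finset.Icc 1 n := by
      simpa [hj1, hjn] using hmem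
    simp only [parkingFunction_iff_countP_le, hlen', true_and, iff_true_intro hmem',
      List.countP_cons, decide_eq_true_eq]
  simp only [Set.ext_iff, Set.mem_ofPred_eq, Finset.coe_Icc, Set.mem_Icc, Finset.mem_Icc]
  constructor
  · intro h
    have hk' := (key k hk.1 hk.2).1 ((h k).2 ⟨hk.1, le_rfl⟩).2
    refine ⟨fun s hs1 hsk => ?_, fun s hs1 hsn => ?_, ?_⟩
    · have := hk' s hs1 (by omega)
      rw [if_pos hsk] at this
      omega
    · exact le_trans (Nat.le_add_right _ _) (hk' s hs1 hsn)
    · rcases hk.2.eq_or_lt with rfl | hlt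
      · rw [Nat.sub_self, List.countP_eq_zero]
        intro x hx
        simpa [Nat.lt_succ_iff] using (Finset.mem_Icc.1 (hmem x hx)).2
      · have hnot : ¬ ParkingFunction m n ((k + 1) :: π) := fun hc => by
          have := (h (k + 1)).1 ⟨by omega, hc⟩
          omega
        rw [key (k + 1) (by omega) hlt] at hnot
        push Not at hnot
        obtain ⟨s, hs1, hsn, hs⟩ := hnot
        have hks := hk' s hs1 hsn
        obtain rfl : s = k + 1 := by
          split_ifs at hs hks <;> omega
        rw [if_pos le_rfl] at hs
        rw [if_neg (by omega)] at hks
        omega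
  · rintro ⟨hlow, hall, heq⟩ j
    constructor
    · rintro ⟨hj, hpf⟩
      refine ⟨hj.1, ?_⟩
      by_contra hkj
      have := (key j hj.1 hj.2).1 hpf (k + 1) (by omega) (by omega)
      rw [if_pos (by omega), heq] at this
      omega
    · rintro ⟨hj1, hjk⟩
      refine ⟨⟨hj1, by omega⟩, (key j hj1 (by omega)).2 fun s hs1 hsn => ?_⟩
      split_ifs with hsj
      · have := hlow s hs1 (by omega)
        omega
      · exact hall s hs1 hsn

theorem mem_ShSet_of_countP {m n k : ℕ} (h1 : 1 ≤ m) (hk : k ∈ Finset.Icc 1 n)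
    {π : List ℕ} (hlen : π.length = m - 1)
    (hmem : ∀ x ∈ π, x ∈ Finset.Icc 1 n)
    (hlow : ∀ s, 1 ≤ s → s ≤ k → π.countP (s ≤ ·) ≤ n - s)
    (hall : ∀ s, 1 ≤ s → s ≤ n → π.countP (s ≤ ·) ≤ n + 1 - s)
    (heq : π.countP (k + 1 ≤ ·) = n - k) : π ∈ ShSet m n k := by
  rw [Finset.mem_Icc] at hk
  have hsh := isShuffle_filter (fun x => decide (x ≤ k)) π
  set a := π.filter fun x => decide (x ≤ k) with ha
  set c := π.filter fun x => !decide (x ≤ k) with hc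
  have hclen : c.length = n - k := by
    rw [← heq, hc, ← List.countP_eq_length_filter]
    congr 1
    funext x
    grind
  have hcmem : ∀ x ∈ c, k < x ∧ x ≤ n := fun x hx => by
    rw [hc, List.mem_filter] at hx
    exact ⟨by simpa using hx.2, (Finset.mem_Icc.1 (hmem x hx.1)).2⟩
  have hcount : ∀ s, π.countP (s ≤ ·) = a.countP (s ≤ ·) + c.countP (s ≤ ·) := fun s => by
    rw [hsh.perm.countP_eq, List.countP_append]
  have hcs : ∀ s, s ≤ k + 1 → c.countP (s ≤ ·) = n - k := fun s hs => by
    rw [← hclen, List.countP_eq_length]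
    intro x hx
    have := hcmem x hx
    exact decide_eq_true (by omega)
  have hak : a.countP (k ≤ ·) = 0 := by
    have := hlow k hk.1 le_rfl
    rw [hcount, hcs k (by omega)] at this
    omega
  have hamem : ∀ x ∈ a, 1 ≤ x ∧ x < k := fun x hx => by
    have hx' := List.countP_eq_zero.1 hak x hx
    refine ⟨(Finset.mem_Icc.1 (hmem x (List.mem_filter.1 hx).1)).1, ?_⟩
    simpa using hx'
  have hlenadd : π.length = a.length + c.length := by
    rw [hsh.perm.length_eq, List.length_append]
  have hcmap : (c.map (· - k)).map (· + k) = c := by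
    rw [List.map_map]
    refine (List.map_congr_left fun x hx => ?_).trans (List.map_id c)
    have := hcmem x hx
    simp only [Function.comp_apply, id]
    omega
  refine ⟨by omega, a, c.map (· - k), ?_, ?_, ?_⟩
  · refine parkingFunction_iff_countP_le.2 ⟨by omega, fun x hx => ?_, fun s hs1 hsk => ?_⟩
    · have := hamem x hx
      exact Finset.mem_Icc.2 (by omega)
    · have := hlow s hs1 (by omega)
      rw [hcount, hcs s (by omega)] at this
      omega
  · refine parkingFunction_iff_countP_le.2 ⟨by simpa using hclen, fun x hx => ?_,
      fun s hs1 hsk => ?_⟩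
    · obtain ⟨y, hy, rfl⟩ := List.mem_map.1 hx
      have := hcmem y hy
      exact Finset.mem_Icc.2 (by omega)
    · have := hall (s + k) (by omega) (by omega)
      rw [hcount, ← hcmap, countP_le_map_add, Nat.add_sub_cancel] at this
      omega
  · rwa [hcmap]

theorem countP_of_mem_ShSet {m n k : ℕ} (hk : k ∈ Finset.Icc 1 n) {π : List ℕ}
    (h : π ∈ ShSet m n k) :
    (∀ s, 1 ≤ s → s ≤ k → π.countP (s ≤ ·) ≤ n - s) ∧
      (∀ s, 1 ≤ s → s ≤ n → π.countP (s ≤ ·) ≤ n + 1 - s) ∧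
      π.countP (k + 1 ≤ ·) = n - k := by
  rw [Finset.mem_Icc] at hk
  obtain ⟨-, a, b, ha, hb, hsh⟩ := h
  obtain ⟨-, hamem, hac⟩ := parkingFunction_iff_countP_le.1 ha
  obtain ⟨hblen, hbmem, hbc⟩ := parkingFunction_iff_countP_le.1 hb
  simp only [hsh.perm.countP_eq, List.countP_append, countP_le_map_add]
  have hzero : ∀ s, k ≤ s → a.countP (s ≤ ·) = 0 := fun s hs => by
    rw [List.countP_eq_zero]
    intro x hx
    have := Finset.mem_Icc.1 (hamem x hx)
    simp only [decide_eq_true_eq]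
    omega
  have hble : ∀ s, b.countP (s ≤ ·) ≤ n - k := fun s => hblen ▸ List.countP_le_length
  have hlow : ∀ s, 1 ≤ s → s ≤ k →
      a.countP (s ≤ ·) + b.countP (s - k ≤ ·) ≤ n - s := fun s hs1 hsk => by
    have hb' := hble (s - k)
    rcases hsk.eq_or_lt with rfl | hlt
    · have := hzero s le_rfl
      omega
    · have := hac s hs1 (by omega)
      omega
  refine ⟨hlow, fun s hs1 hsn => ?_, ?_⟩
  · rcases le_or_gt s k with hsk | hks
    · have := hlow s hs1 hsk
      omega
    · have h1 := hzero s hks.le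
      have h2 := hbc (s - k) (by omega) (by omega)
      omega
  · rw [hzero _ (by omega), Nat.zero_add, Nat.add_sub_cancel_left, ← hblen, List.countP_eq_length]
    intro x hx
    simpa using (Finset.mem_Icc.1 (hbmem x hx)).1

/-- Let `1 ≤ m ≤ n`, `(π_2,…,π_m) ∈ [n]^{m-1}` and `k ∈ [n]`.  Then
`A^n_{(π_2,…,π_m)} = [k]`, where `A^n_π = {j ∈ [n] : (j, π_2, …, π_m) ∈ PF_{m,n}}`,
if and only if `(π_2,…,π_m) ∈ Sh_m(k-1, n-k)`. -/
theorem parking_shuffle_characterization (m n k : ℕ) (h1 : 1 ≤ m) (h2 : m ≤ n)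
    (hk : k ∈ Finset.Icc 1 n) (π : List ℕ) (hlen : π.length = m - 1)
    (hmem : ∀ x ∈ π, x ∈ Finset.Icc 1 n) :
    {j : ℕ | j ∈ Finset.Icc 1 n ∧ ParkingFunction m n (j :: π)} =
        ↑(Finset.Icc 1 k) ↔
      π ∈ ShSet m n k := by
  rw [setOf_parkingFunction_cons_eq_Icc_iff h1 hk hlen hmem]
  exact ⟨fun ⟨hlow, hall, heq⟩ => mem_ShSet_of_countP h1 hk hlen hmem hlow hall heq,
    countP_of_mem_ShSet hk⟩
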